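/- Fix 0 ≤ d ≤ n. Let C^• be a complex of finitely generated left D_n-modules that is bounded below and above. Then there exists a bounded-above complex A^• of finitely generated free D_n-modules together with shift vectors 𝔪_• such that (A^•, 𝔪_•) is V_d-strict and A^• is quasi-isomorphic to C^•. -/

import Mathlib

set_option synthInstance.maxHeartbeats 1000000
set_option maxHeartbeats 4000000
set_option linter.unusedVariables false

open scoped TensorProduct

noncomputable section

/-- The polynomial ring `R = ℂ[x₁,…,xₙ]`. -/
abbrev Rp (n : ℕ) := MvPolynomial (Fin n) ℂ

/-- Multiplication by `xᵢ`, as a `ℂ`-linear endomorphism of `ℂ[x₁,…,xₙ]`. -/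
def mulOp {n : ℕ} (i : Fin n) : Module.End ℂ (Rp n) :=
  LinearMap.mulLeft ℂ (MvPolynomial.X i)

/-- The partial derivative `∂ᵢ`, as a `ℂ`-linear endomorphism of `ℂ[x₁,…,xₙ]`. -/
def derOp {n : ℕ} (i : Fin n) : Module.End ℂ (Rp n) :=
  (MvPolynomial.pderiv i).toLinearMap

/-- The `n`-th Weyl algebra `Dₙ`, realized concretely as the `ℂ`-subalgebra of the
`ℂ`-linear endomorphisms of `ℂ[x₁,…,xₙ]` generated by the multiplication
operators `x₁,…,xₙ` and the partial derivative operators `∂₁,…,∂ₙ`. -/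
def Weyl (n : ℕ) : Subalgebra ℂ (Module.End ℂ (Rp n)) :=
  Algebra.adjoin ℂ (Set.range (mulOp (n := n)) ∪ Set.range (derOp (n := n)))

/-- The element `xᵢ` of the Weyl algebra. -/
def wx {n : ℕ} (i : Fin n) : Weyl n :=
  ⟨mulOp i, Algebra.subset_adjoin (Or.inl ⟨i, rfl⟩)⟩

/-- The element `∂ᵢ` of the Weyl algebra. -/
def wd {n : ℕ} (i : Fin n) : Weyl n :=
  ⟨derOp i, Algebra.subset_adjoin (Or.inr ⟨i, rfl⟩)⟩

instance (priority := 10000) weylRing (n : ℕ) : Ring ↥(Weyl n) :=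
  inferInstanceAs (Ring ↥(Weyl n).toSubring)

instance (priority := 10000) weylAddCommGroup (n : ℕ) : AddCommGroup ↥(Weyl n) :=
  (weylRing n).toAddCommGroup

instance (priority := 10000) weylModC (n : ℕ) : Module ℂ ↥(Weyl n) :=
  inferInstance

instance (priority := 10000) weylAlgebra (n : ℕ) : Algebra ℂ ↥(Weyl n) :=
  inferInstance

/-- The monomial `x^α ∂^β` in the Weyl algebra. -/
def wmono {n : ℕ} (α β : Fin n → ℕ) : Weyl n :=
  (List.ofFn fun i : Fin n => (wx i) ^ (α i)).prod *
    (List.ofFn fun i : Fin n => (wd i) ^ (β i)).prod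

/-- The `V_d`-filtration `F^j(Dₙ)`: the `ℂ`-span of the monomials `x^α ∂^β`
with `|β_H| ≤ |α_H| + j`, where `|γ_H| = γ₁ + … + γ_d`. -/
def Vfil (n d : ℕ) (j : ℤ) : Submodule ℂ (Weyl n) :=
  Submodule.span ℂ { w | ∃ α β : Fin n → ℕ,
    w = wmono α β ∧
    (∑ i : Fin n, if (i : ℕ) < d then (β i : ℤ) else 0) ≤
      (∑ i : Fin n, if (i : ℕ) < d then (α i : ℤ) else 0) + j }

/-- The shifted `V_d`-filtration `F^j[𝔪](A) = Σᵢ F^{j-𝔪(i)}(Dₙ)·eᵢ` on the free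
module `A = Dₙ^m` with shift vector `𝔪`, as a set. -/
def VfilFree (n d : ℕ) {m : ℕ} (𝔪 : Fin m → ℤ) (j : ℤ) : Set (Fin m → Weyl n) :=
  { v | ∀ i, v i ∈ Vfil n d (j - 𝔪 i) }

section Noetherian

variable {A R : Type*} [Ring A] [Ring R]

/-- The elements of `R` of the form `∑_{i < k} f(aᵢ) yⁱ`. -/
def leftPolys (f : A →+* R) (y : R) : ℕ → AddSubgroup R
  | 0 => ⊥
  | k + 1 => ((AddMonoidHom.mulRight (y ^ k)).comp f.toAddMonoidHom).range ⊔ leftPolys f y k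

lemma mem_leftPolys_succ {f : A →+* R} {y : R} {k : ℕ} {r : R} :
    r ∈ leftPolys f y (k + 1) ↔ ∃ a, ∃ p ∈ leftPolys f y k, f a * y ^ k + p = r := by
  simp [leftPolys, AddSubgroup.mem_sup]

lemma leftPolys_mono (f : A →+* R) (y : R) : Monotone (leftPolys f y) :=
  monotone_nat_of_le_succ fun _ ↦ le_sup_right

lemma map_mul_mem_leftPolys (f : A →+* R) (y : R) (a : A) {k : ℕ} {p : R}
    (hp : p ∈ leftPolys f y k) : f a * p ∈ leftPolys f y k := by
  induction k generalizing p with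
  | zero => simp_all [leftPolys]
  | succ k ih =>
    obtain ⟨b, q, hq, rfl⟩ := mem_leftPolys_succ.1 hp
    exact mem_leftPolys_succ.2 ⟨a * b, f a * q, ih hq, by rw [map_mul, mul_add, mul_assoc]⟩

lemma mul_mem_leftPolys {f : A →+* R} {y : R} (h : ∀ a, ∃ b, y * f a = f a * y + f b)
    {k : ℕ} {p : R} (hp : p ∈ leftPolys f y k) : y * p ∈ leftPolys f y (k + 1) := by
  induction k generalizing p with
  | zero => simp_all [leftPolys]
  | succ k ih =>
    obtain ⟨a, q, hq, rfl⟩ := mem_leftPolys_succ.1 hp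
    obtain ⟨b, hb⟩ := h a
    refine mem_leftPolys_succ.2 ⟨a, f b * y ^ k + y * q, add_mem ?_ (ih hq), ?_⟩
    · exact mem_leftPolys_succ.2 ⟨b, 0, zero_mem _, by simp⟩
    · rw [mul_add, ← mul_assoc, hb, add_mul, mul_assoc, ← pow_succ', add_assoc]

/-- The left ideal of leading coefficients of the elements of degree at most `k` of `I`. -/
def leadingIdeal (f : A →+* R) (y : R) (I : Ideal R) (k : ℕ) : Ideal A where
  carrier := {a | ∃ p ∈ leftPolys f y k, f a * y ^ k + p ∈ I}
  add_mem' := by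
    rintro a b ⟨p, hp, hp'⟩ ⟨q, hq, hq'⟩
    refine ⟨p + q, add_mem hp hq, ?_⟩
    rw [map_add, add_mul, add_add_add_comm]
    exact add_mem hp' hq'
  zero_mem' := ⟨0, zero_mem _, by simp⟩
  smul_mem' := by
    rintro c a ⟨p, hp, hp'⟩
    refine ⟨f c * p, map_mul_mem_leftPolys f y c hp, ?_⟩
    rw [smul_eq_mul, map_mul, mul_assoc, ← mul_add]
    exact I.mul_mem_left _ hp'

lemma mem_leadingIdeal {f : A →+* R} {y : R} {I : Ideal R} {k : ℕ} {a : A} :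
    a ∈ leadingIdeal f y I k ↔ ∃ p ∈ leftPolys f y k, f a * y ^ k + p ∈ I := Iff.rfl

lemma leadingIdeal_mono {f : A →+* R} {y : R} (h : ∀ a, ∃ b, y * f a = f a * y + f b)
    (I : Ideal R) : Monotone (leadingIdeal f y I) := by
  refine monotone_nat_of_le_succ fun k a ha ↦ ?_
  obtain ⟨p, hp, hp'⟩ := mem_leadingIdeal.1 ha
  obtain ⟨b, hb⟩ := h a
  refine mem_leadingIdeal.2 ⟨f b * y ^ k + y * p, add_mem ?_ (mul_mem_leftPolys h hp), ?_⟩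
  · exact mem_leftPolys_succ.2 ⟨b, 0, zero_mem _, by simp⟩
  · convert I.mul_mem_left y hp' using 1
    rw [mul_add, ← mul_assoc y, hb, add_mul, mul_assoc, ← pow_succ', add_assoc]

lemma le_of_leadingIdeal_le {f : A →+* R} {y : R} (hgen : ∀ r, ∃ k, r ∈ leftPolys f y k)
    {I J : Ideal R} (hJI : J ≤ I) (hIJ : ∀ k, leadingIdeal f y I k ≤ leadingIdeal f y J k) :
    I ≤ J := by
  have key : ∀ k, ∀ r ∈ leftPolys f y k, r ∈ I → r ∈ J := by
    intro k
    induction k with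
    | zero => intro r hr _; simp_all [leftPolys]
    | succ k ih =>
      intro r hr hrI
      obtain ⟨a, p, hp, rfl⟩ := mem_leftPolys_succ.1 hr
      obtain ⟨q, hq, hqJ⟩ := mem_leadingIdeal.1 (hIJ k (mem_leadingIdeal.2 ⟨p, hp, hrI⟩))
      have := ih (p - q) (sub_mem hp hq) (by
        convert sub_mem hrI (hJI hqJ) using 1; abel)
      convert add_mem hqJ this using 1; abel
  intro r hr
  obtain ⟨k, hk⟩ := hgen r
  exact key k r hk hr

/-- A form of Hilbert's basis theorem for almost normalizing extensions. -/
theorem isNoetherianRing_of_leftPolys [IsNoetherianRing A] {f : A →+* R} {y : R}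
    (h : ∀ a, ∃ b, y * f a = f a * y + f b) (hgen : ∀ r, ∃ k, r ∈ leftPolys f y k) :
    IsNoetherianRing R := by
  classical
  refine isNoetherianRing_iff_ideal_fg R |>.2 fun I ↦ ?_
  have hfin (k : ℕ) : ∃ G : Finset R, (G : Set R) ⊆ I ∧
      ∀ J : Ideal R, (G : Set R) ⊆ J → leadingIdeal f y I k ≤ leadingIdeal f y J k := by
    obtain ⟨t, ht⟩ := IsNoetherian.noetherian (leadingIdeal f y I k)
    have hmem : ∀ a : t, ∃ p ∈ leftPolys f y k, f a * y ^ k + p ∈ I := fun a ↦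
      mem_leadingIdeal.1 (ht ▸ Submodule.subset_span a.2)
    choose p hp hpI using hmem
    refine ⟨Finset.univ.image fun a : t ↦ f a * y ^ k + p a, ?_, fun J hJ ↦ ?_⟩
    · intro r hr
      obtain ⟨a, -, rfl⟩ := Finset.mem_image.1 (Finset.mem_coe.1 hr)
      exact hpI a
    · rw [← ht, Submodule.span_le]
      intro a ha
      exact mem_leadingIdeal.2 ⟨p ⟨a, ha⟩, hp _, hJ (by simpa using ⟨a, ha, rfl⟩)⟩
  choose G hGI hG using hfin
  obtain ⟨K, hK⟩ := monotone_stabilizes_iff_noetherian.2 ‹IsNoetherianRing A›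
    ⟨leadingIdeal f y I, leadingIdeal_mono h I⟩
  let T : Finset R := (Finset.range (K + 1)).biUnion G
  have hGT : ∀ k ≤ K, (G k : Set R) ⊆ Ideal.span (T : Set R) := fun k hk r hr ↦
    Ideal.subset_span <| Finset.mem_coe.2 <|
      Finset.mem_biUnion.2 ⟨k, Finset.mem_range.2 (by lia), hr⟩
  have hTI : Ideal.span (T : Set R) ≤ I := by
    refine Ideal.span_le.2 fun r hr ↦ ?_
    obtain ⟨k, -, hk⟩ := Finset.mem_biUnion.1 (Finset.mem_coe.1 hr)
    exact hGI k hk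
  refine ⟨T, le_antisymm hTI (le_of_leadingIdeal_le hgen hTI fun k ↦ ?_)⟩
  rcases le_total k K with hk | hk
  · exact hG k _ (hGT k hk)
  · calc leadingIdeal f y I k = leadingIdeal f y I K := (hK k hk).symm
      _ ≤ leadingIdeal f y (Ideal.span (T : Set R)) K := hG K _ (hGT K le_rfl)
      _ ≤ _ := leadingIdeal_mono h _ hk

end Noetherian

lemma commutator_mem_adjoin {K E : Type*} [Field K] [Ring E] [Algebra K E] {s : Set E} {y : E}
    (h : ∀ b ∈ s, y * b - b * y ∈ Algebra.adjoin K s) {a : E} (ha : a ∈ Algebra.adjoin K s) :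
    y * a - a * y ∈ Algebra.adjoin K s := by
  induction ha using Algebra.adjoin_induction with
  | mem a ha => exact h a ha
  | algebraMap c =>
    rw [Algebra.commutes, sub_self]
    exact zero_mem _
  | add a b _ _ iha ihb =>
    rw [mul_add, add_mul, add_sub_add_comm]
    exact add_mem iha ihb
  | mul a b ha hb iha ihb =>
    have : y * (a * b) - a * b * y = (y * a - a * y) * b + a * (y * b - b * y) := by
      rw [sub_mul, mul_sub, mul_assoc, mul_assoc, mul_assoc, sub_add_sub_cancel]
    rw [this]
    exact add_mem (mul_mem iha hb) (mul_mem ha ihb)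

lemma exists_mem_leftPolys {K A R : Type*} [Field K] [Ring A] [Algebra K A] [Ring R] [Algebra K R]
    {f : A →ₐ[K] R} {y : R} (h : ∀ a, ∃ b, y * f a = f a * y + f b) {S : Set R}
    (hS : ∀ x ∈ S, x = y ∨ ∃ a, f a = x) {r : R} (hr : r ∈ Algebra.adjoin K S) :
    ∃ k, r ∈ leftPolys (f : A →+* R) y k := by
  have key : ∀ p k, p ∈ leftPolys (f : A →+* R) y k →
      ∃ k, r * p ∈ leftPolys (f : A →+* R) y k := by
    induction hr using Algebra.adjoin_induction with
    | mem r hr =>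
      intro p k hp
      obtain rfl | ⟨a, rfl⟩ := hS r hr
      · exact ⟨k + 1, mul_mem_leftPolys h hp⟩
      · exact ⟨k, map_mul_mem_leftPolys (f : A →+* R) y a hp⟩
    | algebraMap c =>
      intro p k hp
      rw [← f.commutes]
      exact ⟨k, map_mul_mem_leftPolys (f : A →+* R) y _ hp⟩
    | add a b ha hb iha ihb =>
      intro p k hp
      obtain ⟨i, hi⟩ := iha p k hp
      obtain ⟨j, hj⟩ := ihb p k hp
      refine ⟨max i j, ?_⟩
      rw [add_mul]
      exact add_mem (leftPolys_mono _ y (le_max_left i j) hi)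
        (leftPolys_mono _ y (le_max_right i j) hj)
    | mul a b ha hb iha ihb =>
      intro p k hp
      obtain ⟨i, hi⟩ := ihb p k hp
      obtain ⟨j, hj⟩ := iha _ i hi
      exact ⟨j, by rwa [mul_assoc]⟩
  obtain ⟨k, hk⟩ := key 1 1 (mem_leftPolys_succ.2 ⟨1, 0, zero_mem _, by simp⟩)
  exact ⟨k, by simpa using hk⟩

theorem isNoetherianRing_of_adjoin_eq_top {K A R : Type*} [Field K] [Ring A] [Algebra K A]
    [Ring R] [Algebra K R] [IsNoetherianRing A] {f : A →ₐ[K] R} {y : R}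
    (h : ∀ a, ∃ b, y * f a = f a * y + f b) {S : Set R}
    (hS : ∀ x ∈ S, x = y ∨ ∃ a, f a = x) (hS' : Algebra.adjoin K S = ⊤) :
    IsNoetherianRing R :=
  isNoetherianRing_of_leftPolys (f := (f : A →+* R)) h fun r ↦
    exists_mem_leftPolys h hS (hS' ▸ Algebra.mem_top)

/-- A subalgebra generated by finitely many elements with scalar commutators is left Noetherian. -/
theorem isNoetherianRing_adjoin_of_commutator {K E : Type*} [Field K] [Ring E] [Algebra K E]
    {S : Set E} (hS : S.Finite)
    (hcomm : ∀ a ∈ S, ∀ b ∈ S, a * b - b * a ∈ (⊥ : Subalgebra K E)) :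
    IsNoetherianRing (Algebra.adjoin K S) := by
  induction S, hS using Set.Finite.induction_on with
  | empty =>
    rw [Algebra.adjoin_empty]
    exact isNoetherianRing_of_surjective K _ (algebraMap K (⊥ : Subalgebra K E)) (by
      rintro ⟨x, hx⟩
      obtain ⟨c, rfl⟩ := Algebra.mem_bot.1 hx
      exact ⟨c, rfl⟩)
  | @insert y s _ _ ih =>
    have := ih fun a ha b hb ↦ hcomm a (.inr ha) b (.inr hb)
    have hle : Algebra.adjoin K s ≤ Algebra.adjoin K (insert y s) :=
      Algebra.adjoin_mono (Set.subset_insert _ _)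
    refine isNoetherianRing_of_adjoin_eq_top (f := Subalgebra.inclusion hle)
      (y := ⟨y, Algebra.subset_adjoin (.inl rfl)⟩) (fun a ↦ ?_)
      (S := Subtype.val ⁻¹' insert y s) ?_ (Algebra.adjoin_adjoin_coe_preimage ..)
    · exact ⟨⟨_, commutator_mem_adjoin
        (fun b hb ↦ bot_le (a := Algebra.adjoin K s) (hcomm y (.inl rfl) b (.inr hb))) a.2⟩,
        Subtype.ext (add_sub_cancel (a * y : E) (y * a)).symm⟩
    · rintro ⟨x, hx⟩ (h | hxs)
      · exact .inl (Subtype.ext h)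
      · exact .inr ⟨⟨x, Algebra.subset_adjoin hxs⟩, rfl⟩

section Filtered

open AddMonoidAlgebra

variable {D : Type*} [Ring D]

lemma coeff_mul_sub_eq_sum (c f : AddMonoidAlgebra D ℤ) (J : Finset ℤ) (m j : ℤ)
    (hJ : ∀ b ∈ f.coeff.support, b + m ∈ J) :
    (c * f).coeff (j - m) = ∑ a ∈ J, c.coeff (j - a) * f.coeff (a - m) := by
  have hf : f = ∑ a ∈ J, single (a - m) (f.coeff (a - m)) := by
    ext b
    rw [coeff_sum, Finsupp.finsetSum_apply]
    simp only [coeff_single]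
    by_cases hb : b + m ∈ J
    · rw [Finset.sum_eq_single_of_mem _ hb]
      · simp
      · intro a _ ha
        exact Finsupp.single_eq_of_ne (by lia)
    · rw [Finset.sum_eq_zero]
      · by_contra h
        exact hb (hJ b (Finsupp.mem_support_iff.2 h))
      · intro a ha
        exact Finsupp.single_eq_of_ne (by rintro rfl; simp [ha] at hb)
  conv_lhs => rw [hf, Finset.mul_sum, coeff_sum, Finsupp.finsetSum_apply]
  exact Finset.sum_congr rfl fun a _ ↦
    coeff_mul_single_eq_coeff_mul _ fun b _ ↦ by lia

variable {K : Type*} [Field K] [Algebra K D] (E : Subalgebra K (AddMonoidAlgebra D ℤ))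

/-- The Rees module of a submodule of a free module with shift vector `m`. -/
def reesSubmodule {r : ℕ} (m : Fin r → ℤ) (N : Submodule D (Fin r → D)) :
    Submodule E (Fin r → E) where
  carrier := {f | ∀ j, (fun i ↦ (f i : AddMonoidAlgebra D ℤ).coeff (j - m i)) ∈ N}
  add_mem' := fun ha hb j ↦ N.add_mem (ha j) (hb j)
  zero_mem' := fun j ↦ N.zero_mem
  smul_mem' := by
    classical
    intro c f hf j
    let J : Finset ℤ := Finset.univ.biUnion fun i ↦
      (f i : AddMonoidAlgebra D ℤ).coeff.support.image (· + m i)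
    have : (fun i ↦ ((c • f) i : AddMonoidAlgebra D ℤ).coeff (j - m i)) =
        ∑ a ∈ J, (c : AddMonoidAlgebra D ℤ).coeff (j - a) •
          fun i ↦ (f i : AddMonoidAlgebra D ℤ).coeff (a - m i) := by
      ext i
      rw [Finset.sum_apply]
      refine coeff_mul_sub_eq_sum _ _ J _ _ fun b hb ↦ ?_
      exact Finset.mem_biUnion.2 ⟨i, Finset.mem_univ _, Finset.mem_image.2 ⟨b, hb, rfl⟩⟩
    rw [this]
    exact N.sum_mem fun a _ ↦ N.smul_mem _ (hf a)

/-- If the Rees ring of a filtration is Noetherian, then every submodule of a shifted free module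
has a finite generating family that generates the induced filtration. -/
theorem exists_filtered_generators [IsNoetherianRing E] (F : ℤ → Submodule K D)
    (hEF : ∀ e ∈ E, ∀ j, e.coeff j ∈ F j) (hFE : ∀ j, ∀ w ∈ F j, single j w ∈ E)
    {r : ℕ} (m : Fin r → ℤ) (N : Submodule D (Fin r → D)) :
    ∃ (s : ℕ) (m' : Fin s → ℤ) (v : Fin s → Fin r → D), (∀ l, v l ∈ N) ∧
      (∀ l i, v l i ∈ F (m' l - m i)) ∧
      ∀ j, ∀ w ∈ N, (∀ i, w i ∈ F (j - m i)) →
        ∃ c : Fin s → D, (∀ l, c l ∈ F (j - m' l)) ∧ ∑ l, c l • v l = w := by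
  classical
  obtain ⟨t, g, hg⟩ := Submodule.fg_iff_exists_fin_generating_family.1
    (IsNoetherian.noetherian (reesSubmodule E m N))
  let J : Finset ℤ := Finset.univ.biUnion fun l ↦ Finset.univ.biUnion fun i ↦
    (g l i : AddMonoidAlgebra D ℤ).coeff.support.image (· + m i)
  let e : Fin (Fintype.card (Fin t × J)) ≃ Fin t × J := (Fintype.equivFin _).symm
  have hgN : ∀ l, g l ∈ reesSubmodule E m N := fun l ↦ hg ▸ Submodule.subset_span ⟨l, rfl⟩
  refine ⟨_, fun p ↦ (e p).2,
    fun p i ↦ (g (e p).1 i : AddMonoidAlgebra D ℤ).coeff ((e p).2 - m i),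
    fun p ↦ hgN (e p).1 _, fun p i ↦ hEF _ (g (e p).1 i).2 _, fun j w hw hwF ↦ ?_⟩
  let f : Fin r → E := fun i ↦ ⟨single (j - m i) (w i), hFE _ _ (hwF i)⟩
  have hf : f ∈ reesSubmodule E m N := by
    intro k
    by_cases hk : k = j
    · subst hk
      convert hw using 1
      ext i
      exact Finsupp.single_eq_same
    · convert N.zero_mem using 1
      ext i
      exact Finsupp.single_eq_of_ne (by lia)
  rw [← hg, Submodule.mem_span_range_iff_exists_fun] at hf
  obtain ⟨c, hc⟩ := hf
  refine ⟨fun p ↦ (c (e p).1 : AddMonoidAlgebra D ℤ).coeff (j - (e p).2),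
    fun p ↦ hEF _ (c _).2 _, ?_⟩
  rw [e.sum_comp (fun q : Fin t × J ↦ (c q.1 : AddMonoidAlgebra D ℤ).coeff (j - q.2) •
    fun i ↦ (g q.1 i : AddMonoidAlgebra D ℤ).coeff (q.2 - m i)), Fintype.sum_prod_type]
  ext i
  have hci : (f i : AddMonoidAlgebra D ℤ) =
      ∑ l, (c l : AddMonoidAlgebra D ℤ) * (g l i : AddMonoidAlgebra D ℤ) := by
    rw [← hc, Finset.sum_apply, AddSubmonoidClass.coe_finsetSum]
    rfl
  have hwi : w i = (f i : AddMonoidAlgebra D ℤ).coeff (j - m i) :=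
    Finsupp.single_eq_same.symm
  rw [hwi, hci, coeff_sum, Finsupp.finsetSum_apply, Finset.sum_apply]
  refine Finset.sum_congr rfl fun l _ ↦ ?_
  rw [coeff_mul_sub_eq_sum _ _ J _ _ fun b hb ↦ ?_, Finset.sum_apply, Finset.univ_eq_attach,
    ← Finset.sum_attach J]
  · rfl
  · exact Finset.mem_biUnion.2 ⟨l, Finset.mem_univ _,
      Finset.mem_biUnion.2 ⟨i, Finset.mem_univ _, Finset.mem_image.2 ⟨b, hb, rfl⟩⟩⟩

end Filtered

section Resolution

variable {K D : Type*} [Field K] [Ring D] [Algebra K D]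

/-- One term of a free resolution: a free module with a shift vector, its map to the complex being
resolved, and the kernel of its differential. -/
structure ResolutionTerm (D : Type*) [Ring D] (M : Type*) [AddCommGroup M] [Module D M] where
  /-- The rank. -/
  rank : ℕ
  /-- The shift vector. -/
  shift : Fin rank → ℤ
  /-- The augmentation. -/
  aug : (Fin rank → D) →ₗ[D] M
  /-- The cycles. -/
  cycles : Submodule D (Fin rank → D)

/-- `φ` is a strict differential from `s` to `t` covering `δ`, which makes `t` exact. -/
structure IsStrictDifferential (F : ℤ → Submodule K D) {M N : Type*} [AddCommGroup M] [Module D M]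
    [AddCommGroup N] [Module D N] (δ : M →ₗ[D] N) (s : ResolutionTerm D M)
    (t : ResolutionTerm D N) (φ : (Fin s.rank → D) →ₗ[D] (Fin t.rank → D)) : Prop where
  mem_cycles_left : ∀ v, v ∈ s.cycles ↔ φ v = 0
  mem_range : ∀ v, (∃ u, φ u = v) ↔ v ∈ t.cycles ∧ ∃ y, t.aug v = δ y
  aug_comm : ∀ v, t.aug (φ v) = δ (s.aug v)
  adapted : ∀ j, ∀ v : Fin s.rank → D, (∀ i, v i ∈ F (j - s.shift i)) →
    ∀ i, φ v i ∈ F (j - t.shift i)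
  strict : ∀ j, ∀ v : Fin t.rank → D, (∀ i, v i ∈ F (j - t.shift i)) → (∃ u, φ u = v) →
    ∃ u : Fin s.rank → D, (∀ i, u i ∈ F (j - s.shift i)) ∧ φ u = v
  exists_aug_eq : ∀ x, δ x = 0 → ∃ v ∈ s.cycles, s.aug v = x

/-- Every submodule of a shifted free module is generated by finitely many elements which also
generate the induced filtration. -/
def HasFilteredGenerators (F : ℤ → Submodule K D) : Prop :=
  ∀ {r : ℕ} (m : Fin r → ℤ) (N : Submodule D (Fin r → D)),
    ∃ (s : ℕ) (m' : Fin s → ℤ) (v : Fin s → Fin r → D), (∀ l, v l ∈ N) ∧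
      (∀ l i, v l i ∈ F (m' l - m i)) ∧
      ∀ j, ∀ w ∈ N, (∀ i, w i ∈ F (j - m i)) →
        ∃ c : Fin s → D, (∀ l, c l ∈ F (j - m' l)) ∧ ∑ l, c l • v l = w

lemma exists_forall_mem {F : ℤ → Submodule K D} (hF : Monotone F)
    (hex : ∀ w, ∃ j, w ∈ F j) {r : ℕ} (m : Fin r → ℤ) (v : Fin r → D) :
    ∃ j, ∀ i, v i ∈ F (j - m i) := by
  choose a ha using fun i ↦ hex (v i)
  obtain ⟨j, hj⟩ := (Finset.univ.image fun i ↦ a i + m i).bddAbove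
  refine ⟨j, fun i ↦ hF ?_ (ha i)⟩
  have := hj (Finset.mem_coe.2 (Finset.mem_image_of_mem (fun i ↦ a i + m i) (Finset.mem_univ i)))
  lia

theorem exists_isStrictDifferential [IsNoetherianRing D] {F : ℤ → Submodule K D}
    (hmono : Monotone F) (hex : ∀ w, ∃ j, w ∈ F j)
    (hmul : ∀ i j, ∀ a ∈ F i, ∀ b ∈ F j, a * b ∈ F (i + j)) (hF : HasFilteredGenerators F)
    {M N : Type*} [AddCommGroup M] [Module D M] [Module.Finite D M] [AddCommGroup N] [Module D N]
    (δ : M →ₗ[D] N) (t : ResolutionTerm D N) :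
    ∃ (s : ResolutionTerm D M) (φ : _), IsStrictDifferential F δ s t φ := by
  obtain ⟨p, m, v, hvB, hvF, hv⟩ :=
    hF t.shift (t.cycles ⊓ (LinearMap.range δ).comap t.aug)
  have hy (l) : ∃ y, δ y = t.aug (v l) := (hvB l).2
  choose y hy using hy
  obtain ⟨q, z, hz⟩ := Submodule.fg_iff_exists_fin_generating_family.1
    (IsNoetherian.noetherian (LinearMap.ker δ))
  have hzδ (l) : δ (z l) = 0 := by
    have : z l ∈ LinearMap.ker δ := hz ▸ Submodule.subset_span ⟨l, rfl⟩
    exact this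
  let φ : (Fin (p + q) → D) →ₗ[D] (Fin t.rank → D) :=
    Fintype.linearCombination D (Fin.append v 0)
  let g : (Fin (p + q) → D) →ₗ[D] M := Fintype.linearCombination D (Fin.append y z)
  have hφ (c : Fin (p + q) → D) : φ c = ∑ l, c (Fin.castAdd q l) • v l := by
    simp [φ, Fintype.linearCombination_apply, Fin.sum_univ_add]
  have hg (c : Fin (p + q) → D) :
      g c = ∑ l, c (Fin.castAdd q l) • y l + ∑ l, c (Fin.natAdd p l) • z l := by
    simp [g, Fintype.linearCombination_apply, Fin.sum_univ_add]
  have hcomm (c) : t.aug (φ c) = δ (g c) := by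
    simp [hφ, hg, hy, hzδ]
  have hstrict (j) (w : Fin t.rank → D) (hw : ∀ i, w i ∈ F (j - t.shift i))
      (hwB : w ∈ t.cycles ⊓ (LinearMap.range δ).comap t.aug) :
      ∃ u : Fin (p + q) → D, (∀ i, u i ∈ F (j - Fin.append m 0 i)) ∧ φ u = w := by
    obtain ⟨c, hc, rfl⟩ := hv j w hwB hw
    refine ⟨Fin.append c 0, fun i ↦ ?_, by simp [hφ]⟩
    refine Fin.addCases (fun l ↦ ?_) (fun l ↦ ?_) i
    · simpa using hc l
    · simp
  have hrange (c) : φ c ∈ t.cycles ⊓ (LinearMap.range δ).comap t.aug := by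
    rw [hφ]
    exact Submodule.sum_mem _ fun l _ ↦ Submodule.smul_mem _ _ (hvB l)
  refine ⟨⟨p + q, Fin.append m 0, g, LinearMap.ker φ⟩, φ, ?_, ?_, hcomm, ?_, ?_, ?_⟩
  · exact fun _ ↦ Iff.rfl
  · refine fun w ↦ ⟨?_, ?_⟩
    · rintro ⟨u, rfl⟩
      exact ⟨(hrange u).1, g u, hcomm u⟩
    · rintro ⟨hw, x, hx⟩
      obtain ⟨j, hj⟩ := exists_forall_mem hmono hex t.shift w
      obtain ⟨u, -, hu⟩ := hstrict j w hj ⟨hw, x, hx.symm⟩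
      exact ⟨u, hu⟩
  · intro j c hc i
    change φ c i ∈ _
    rw [hφ, Finset.sum_apply]
    refine Submodule.sum_mem _ fun l _ ↦ ?_
    have := hmul _ _ _ (hc (Fin.castAdd q l)) _ (hvF l i)
    simpa using this
  · rintro j w hw ⟨u, rfl⟩
    exact hstrict j _ hw (hrange u)
  · intro x hx
    have : x ∈ Submodule.span D (Set.range z) := hz ▸ hx
    obtain ⟨c, rfl⟩ := (Submodule.mem_span_range_iff_exists_fun D).1 this
    exact ⟨Fin.append 0 c, by simp [hφ], by simp [hg]⟩

/-- The zero term. -/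
def zeroTerm (D : Type*) [Ring D] (M : Type*) [AddCommGroup M] [Module D M] :
    ResolutionTerm D M :=
  ⟨0, 0, 0, ⊤⟩

lemma isStrictDifferential_zeroTerm (F : ℤ → Submodule K D) {M N : Type*} [AddCommGroup M]
    [Module D M] [AddCommGroup N] [Module D N] (δ : M →ₗ[D] N) (hM : ∀ x : M, x = 0)
    (t : ResolutionTerm D N) (ht : t = zeroTerm D N) :
    IsStrictDifferential F δ (zeroTerm D M) t 0 := by
  subst ht
  have h (v : Fin (zeroTerm D N).rank → D) : v = 0 := funext fun i ↦ i.elim0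
  refine ⟨fun v ↦ ⟨fun _ ↦ rfl, fun _ ↦ trivial⟩, fun v ↦ ?_, fun v ↦ ?_, fun _ _ _ i ↦ i.elim0,
    fun _ v _ _ ↦ ⟨0, fun i ↦ i.elim0, (h v).symm⟩, fun x _ ↦ ⟨0, ?_, ?_⟩⟩
  · rw [h v]
    exact ⟨fun _ ↦ ⟨Submodule.zero_mem _, 0, by simp⟩, fun _ ↦ ⟨0, rfl⟩⟩
  · simp [hM (ResolutionTerm.aug _ v)]
  · exact Submodule.zero_mem _
  · rw [hM x, map_zero]

theorem exists_terms [IsNoetherianRing D] {F : ℤ → Submodule K D}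
    (hmono : Monotone F) (hex : ∀ w, ∃ j, w ∈ F j)
    (hmul : ∀ i j, ∀ a ∈ F i, ∀ b ∈ F j, a * b ∈ F (i + j)) (hF : HasFilteredGenerators F)
    (C : ℤ → Type*) [∀ q, AddCommGroup (C q)] [∀ q, Module D (C q)]
    [∀ q, Module.Finite D (C q)] (dC : ∀ i j : ℤ, C i →ₗ[D] C j) (b : ℤ)
    (hb : ∀ q, b ≤ q → ∀ x : C q, x = 0) :
    ∃ s : ∀ q, ResolutionTerm D (C q), (∀ q, b ≤ q → (s q).rank = 0) ∧
      ∀ i j : ℤ, i = j - 1 → ∃ φ, IsStrictDifferential F (dC i j) (s i) (s j) φ := by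
  choose next hnext using fun (j : ℤ) (t : ResolutionTerm D (C j)) ↦
    exists_isStrictDifferential hmono hex hmul hF (dC (j - 1) j) t
  let s : ∀ q, ResolutionTerm D (C q) := fun q ↦
    Int.inductionOn' q b (zeroTerm D (C b)) (fun k _ _ ↦ zeroTerm D _) (fun k _ t ↦ next k t)
  have hs : ∀ q, b ≤ q → s q = zeroTerm D (C q) := by
    intro q hq
    induction q, hq using Int.leInduction with
    | base => exact Int.inductionOn'_self
    | succ q hq _ => exact Int.inductionOn'_add_one hq
  refine ⟨s, fun q hq ↦ by rw [hs q hq]; rfl, ?_⟩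
  rintro i j rfl
  by_cases hj : j ≤ b
  · have : s (j - 1) = next j (s j) := Int.inductionOn'_sub_one hj
    rw [this]
    exact hnext j (s j)
  · rw [hs (j - 1) (by lia)]
    exact ⟨0, isStrictDifferential_zeroTerm F _ (hb _ (by lia)) _ (hs j (by lia))⟩

end Resolution

section Weyl

lemma mul_prod_ofFn_pow {M : Type*} [Monoid M] {n : ℕ} (y : Fin n → M)
    (hy : ∀ i j, Commute (y i) (y j)) (i : Fin n) (α : Fin n → ℕ) :
    y i * (List.ofFn fun k ↦ y k ^ α k).prod =
      (List.ofFn fun k ↦ y k ^ (α + Pi.single i 1 : Fin n → ℕ) k).prod := by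
  induction n with
  | zero => exact i.elim0
  | succ n ih =>
    simp only [List.ofFn_succ, List.prod_cons]
    refine Fin.cases ?_ (fun i ↦ ?_) i
    · simp [pow_succ', mul_assoc]
    · have := ih (fun k ↦ y k.succ) (fun _ _ ↦ hy _ _) i fun k ↦ α k.succ
      rw [← mul_assoc, ((hy i.succ 0).pow_right _).eq, mul_assoc, this]
      simp [Pi.single_apply, Fin.succ_inj]

variable {n : ℕ}

lemma wx_commute (i j : Fin n) : Commute (wx i) (wx j) :=
  Subtype.ext <| LinearMap.ext fun p ↦ mul_left_comm _ _ _

lemma wd_commute (i j : Fin n) : Commute (wd i) (wd j) := by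
  refine Subtype.ext <| LinearMap.ext fun p ↦ ?_
  change MvPolynomial.pderiv i (MvPolynomial.pderiv j p) =
    MvPolynomial.pderiv j (MvPolynomial.pderiv i p)
  have : ⁅(MvPolynomial.pderiv i : Derivation ℂ (Rp n) (Rp n)),
      (MvPolynomial.pderiv j : Derivation ℂ (Rp n) (Rp n))⁆ = 0 := by
    classical
    refine MvPolynomial.derivation_ext fun k ↦ ?_
    rw [Derivation.commutator_apply, MvPolynomial.pderiv_X, MvPolynomial.pderiv_X,
      Pi.single_apply, Pi.single_apply]
    split_ifs <;> simp
  exact sub_eq_zero.1 (DFunLike.congr_fun this p)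

lemma coe_prod_wx_pow (α : Fin n → ℕ) (p : Rp n) :
    ((List.ofFn fun i : Fin n ↦ wx i ^ α i).prod : Weyl n).1 p =
      MvPolynomial.monomial (Finsupp.equivFunOnFinite.symm α) 1 * p := by
  have h1 : ((List.ofFn fun i : Fin n ↦ wx i ^ α i).prod : Weyl n).1 =
      Algebra.lmul ℂ (Rp n) (List.ofFn fun i ↦ MvPolynomial.X i ^ α i).prod := by
    refine (map_list_prod (Weyl n).val _).trans ?_
    rw [map_list_prod, List.map_ofFn, List.map_ofFn]
    congr 2
    ext1 i
    exact (map_pow (Weyl n).val (wx i) (α i)).trans (map_pow (Algebra.lmul ℂ (Rp n)) _ _).symm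
  rw [h1, List.prod_ofFn, MvPolynomial.monomial_eq, Finsupp.prod_fintype _ _ (by simp)]
  simp

lemma wd_mul_prod_wx_pow (i : Fin n) (α : Fin n → ℕ) :
    wd i * (List.ofFn fun k : Fin n ↦ wx k ^ α k).prod =
      (List.ofFn fun k : Fin n ↦ wx k ^ α k).prod * wd i +
        (α i : ℂ) • (List.ofFn fun k : Fin n ↦ wx k ^ (α - Pi.single i 1 : Fin n → ℕ) k).prod := by
  refine Subtype.ext <| LinearMap.ext fun p ↦ ?_
  change MvPolynomial.pderiv i (((List.ofFn fun k : Fin n ↦ wx k ^ α k).prod : Weyl n).1 p) =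
    ((List.ofFn fun k : Fin n ↦ wx k ^ α k).prod : Weyl n).1 (MvPolynomial.pderiv i p) +
      (α i : ℂ) •
        ((List.ofFn fun k : Fin n ↦ wx k ^ (α - Pi.single i 1 : Fin n → ℕ) k).prod : Weyl n).1 p
  have : Finsupp.equivFunOnFinite.symm α - Finsupp.single i 1 =
      Finsupp.equivFunOnFinite.symm (α - Pi.single i 1) := by
    classical
    ext k
    simp [Finsupp.single_apply, Pi.single_apply, eq_comm]
  rw [coe_prod_wx_pow, coe_prod_wx_pow, coe_prod_wx_pow, MvPolynomial.pderiv_mul,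
    MvPolynomial.pderiv_monomial, this, add_comm, ← smul_mul_assoc, MvPolynomial.smul_monomial]
  simp

lemma wx_mul_wmono (i : Fin n) (α β : Fin n → ℕ) :
    wx i * wmono α β = wmono (α + Pi.single i 1) β := by
  rw [wmono, ← mul_assoc, mul_prod_ofFn_pow wx wx_commute, wmono]

lemma wd_mul_wmono (i : Fin n) (α β : Fin n → ℕ) :
    wd i * wmono α β =
      wmono α (β + Pi.single i 1) + (α i : ℂ) • wmono (α - Pi.single i 1) β := by
  rw [wmono, ← mul_assoc, wd_mul_prod_wx_pow, add_mul, mul_assoc,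
    mul_prod_ofFn_pow wd wd_commute, smul_mul_assoc, wmono, wmono]

lemma wd_mul_wx (i j : Fin n) :
    wd i * wx j - wx j * wd i = algebraMap ℂ (Weyl n) (if i = j then 1 else 0) := by
  refine Subtype.ext <| LinearMap.ext fun p ↦ ?_
  change MvPolynomial.pderiv i (MvPolynomial.X j * p) -
    MvPolynomial.X j * MvPolynomial.pderiv i p = (if i = j then (1 : ℂ) else 0) • p
  classical
  rw [MvPolynomial.pderiv_mul, MvPolynomial.pderiv_X, add_sub_cancel_right, Pi.single_apply]
  simp only [@eq_comm _ j i]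
  split_ifs <;> simp

instance isNoetherianRing_weyl (n : ℕ) : IsNoetherianRing (Weyl n) := by
  refine isNoetherianRing_adjoin_of_commutator
    ((Set.finite_range _).union (Set.finite_range _)) ?_
  have hdx (i j : Fin n) : derOp i * mulOp j - mulOp j * derOp i ∈
      (⊥ : Subalgebra ℂ (Module.End ℂ (Rp n))) :=
    Algebra.mem_bot.2 ⟨_, (congrArg Subtype.val (wd_mul_wx i j)).symm⟩
  rintro _ (⟨i, rfl⟩ | ⟨i, rfl⟩) _ (⟨j, rfl⟩ | ⟨j, rfl⟩)
  · have : mulOp i * mulOp j = mulOp j * mulOp i := congrArg Subtype.val (wx_commute i j).eq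
    rw [this, sub_self]
    exact zero_mem _
  · rw [← neg_sub]
    exact neg_mem (hdx j i)
  · exact hdx i j
  · have : derOp i * derOp j = derOp j * derOp i := congrArg Subtype.val (wd_commute i j).eq
    rw [this, sub_self]
    exact zero_mem _

/-- The weight `|γ_H|` of a multi-index. -/
def hWeight (d : ℕ) (γ : Fin n → ℕ) : ℤ :=
  ∑ i : Fin n, if (i : ℕ) < d then (γ i : ℤ) else 0

/-- The weight of the `i`-th coordinate. -/
def coordWeight (d : ℕ) (i : Fin n) : ℤ :=
  if (i : ℕ) < d then 1 else 0

lemma hWeight_zero (d : ℕ) : hWeight d (0 : Fin n → ℕ) = 0 := by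
  simp [hWeight]

lemma hWeight_add_single (d : ℕ) (γ : Fin n → ℕ) (i : Fin n) :
    hWeight d (γ + Pi.single i 1) = hWeight d γ + coordWeight d i := by
  have (k : Fin n) : (if (k : ℕ) < d then (((γ + Pi.single i 1 : Fin n → ℕ) k : ℕ) : ℤ) else 0) =
      (if (k : ℕ) < d then (γ k : ℤ) else 0) + if k = i then coordWeight d i else 0 := by
    by_cases hk : k = i
    · subst hk
      simp only [coordWeight, Pi.add_apply, Pi.single_eq_same, if_true]
      split_ifs <;> simp
    · simp [hk]
  rw [hWeight, Finset.sum_congr rfl fun k _ ↦ this k, Finset.sum_add_distrib,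
    Finset.sum_ite_eq' Finset.univ i, if_pos (Finset.mem_univ i), hWeight]

lemma hWeight_sub_single (d : ℕ) {γ : Fin n → ℕ} {i : Fin n} (h : γ i ≠ 0) :
    hWeight d (γ - Pi.single i 1) = hWeight d γ - coordWeight d i := by
  have : γ - Pi.single i 1 + Pi.single i 1 = γ := by
    ext k
    by_cases hk : k = i
    · subst hk
      simpa using Nat.sub_add_cancel (Nat.pos_of_ne_zero h)
    · simp [hk]
  rw [eq_sub_iff_add_eq, ← hWeight_add_single, this]

lemma wmono_mem_Vfil {d : ℕ} {j : ℤ} {α β : Fin n → ℕ} (h : hWeight d β ≤ hWeight d α + j) :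
    wmono α β ∈ Vfil n d j :=
  Submodule.subset_span ⟨α, β, rfl, h⟩

lemma Vfil_le {d : ℕ} {j : ℤ} {P : Submodule ℂ (Weyl n)}
    (h : ∀ α β : Fin n → ℕ, hWeight d β ≤ hWeight d α + j → wmono α β ∈ P) : Vfil n d j ≤ P :=
  Submodule.span_le.2 fun _ ⟨α, β, hw, hαβ⟩ ↦ hw ▸ h α β hαβ

lemma Vfil_mono (n d : ℕ) : Monotone (Vfil n d) :=
  fun _ _ hij ↦ Vfil_le fun _ _ h ↦ wmono_mem_Vfil (h.trans (by lia))

lemma one_mem_Vfil (n d : ℕ) : 1 ∈ Vfil n d 0 := by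
  have h : (wmono 0 0 : Weyl n) ∈ Vfil n d 0 := wmono_mem_Vfil (by simp [hWeight_zero])
  simpa [wmono] using h

lemma wx_mul_mem_Vfil {d : ℕ} {j : ℤ} {z : Weyl n} (i : Fin n) (hz : z ∈ Vfil n d j) :
    wx i * z ∈ Vfil n d (-coordWeight d i + j) := by
  refine Vfil_le (P := (Vfil n d _).comap (LinearMap.mulLeft ℂ (wx i))) (fun α β h ↦ ?_) hz
  rw [Submodule.mem_comap, LinearMap.mulLeft_apply, wx_mul_wmono]
  exact wmono_mem_Vfil (by rw [hWeight_add_single]; lia)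

lemma wd_mul_mem_Vfil {d : ℕ} {j : ℤ} {z : Weyl n} (i : Fin n) (hz : z ∈ Vfil n d j) :
    wd i * z ∈ Vfil n d (coordWeight d i + j) := by
  refine Vfil_le (P := (Vfil n d _).comap (LinearMap.mulLeft ℂ (wd i))) (fun α β h ↦ ?_) hz
  rw [Submodule.mem_comap, LinearMap.mulLeft_apply, wd_mul_wmono]
  refine add_mem (wmono_mem_Vfil (by rw [hWeight_add_single]; lia)) ?_
  by_cases hα : α i = 0
  · rw [hα, Nat.cast_zero, zero_smul]
    exact zero_mem _
  · exact Submodule.smul_mem _ _ (wmono_mem_Vfil (by rw [hWeight_sub_single d hα]; lia))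

lemma wmono_mem_graded {d : ℕ} (G : ℤ → Submodule ℂ (Weyl n)) [SetLike.GradedMonoid G]
    (hx : ∀ i, wx i ∈ G (-coordWeight d i)) (hd : ∀ i, wd i ∈ G (coordWeight d i))
    (α β : Fin n → ℕ) : wmono α β ∈ G (hWeight d β - hWeight d α) := by
  have h := SetLike.mul_mem_graded
    (SetLike.list_prod_ofFn_mem_graded _ _ fun i ↦ SetLike.pow_mem_graded (α i) (hx i))
    (SetLike.list_prod_ofFn_mem_graded _ _ fun i ↦ SetLike.pow_mem_graded (β i) (hd i))
  have hsum : (List.ofFn fun i ↦ α i • -coordWeight d i).sum +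
      (List.ofFn fun i ↦ β i • coordWeight d i).sum = hWeight d β - hWeight d α := by
    rw [List.sum_ofFn, List.sum_ofFn, hWeight, hWeight, ← Finset.sum_sub_distrib,
      ← Finset.sum_add_distrib]
    refine Finset.sum_congr rfl fun i _ ↦ ?_
    simp only [coordWeight]
    split_ifs
    · simp only [nsmul_eq_mul, mul_neg, mul_one]
      ring
    · simp
  rw [← hsum]
  exact h

/-- The elements of the Weyl algebra which raise the degree of the `V_d`-filtration by at
most `k`. -/
def Vfil.shifting (n d : ℕ) (k : ℤ) : Submodule ℂ (Weyl n) where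
  carrier := {a | ∀ j, ∀ z ∈ Vfil n d j, a * z ∈ Vfil n d (k + j)}
  add_mem' := fun ha hb j z hz ↦ by
    rw [add_mul]
    exact add_mem (ha j z hz) (hb j z hz)
  zero_mem' := fun j z _ ↦ by
    rw [zero_mul]
    exact zero_mem _
  smul_mem' := fun c a ha j z hz ↦ by
    rw [smul_mul_assoc]
    exact Submodule.smul_mem _ _ (ha j z hz)

instance (n d : ℕ) : SetLike.GradedMonoid (Vfil.shifting n d) where
  one_mem := fun j z hz ↦ by rwa [one_mul, zero_add]
  mul_mem := fun i j a b ha hb k z hz ↦ by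
    rw [mul_assoc, add_assoc]
    exact ha _ _ (hb _ _ hz)

lemma mul_mem_Vfil {d : ℕ} {i j : ℤ} {a b : Weyl n} (ha : a ∈ Vfil n d i)
    (hb : b ∈ Vfil n d j) : a * b ∈ Vfil n d (i + j) := by
  refine Vfil_le (P := (Vfil n d (i + j)).comap (LinearMap.mulRight ℂ b)) (fun α β h ↦ ?_) ha
  exact Vfil_mono n d (by lia) (wmono_mem_graded (d := d) (Vfil.shifting n d)
    (fun i j z hz ↦ wx_mul_mem_Vfil i hz) (fun i j z hz ↦ wd_mul_mem_Vfil i hz) α β j b hb)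

lemma wx_mem_Vfil (d : ℕ) (i : Fin n) : wx i ∈ Vfil n d (-coordWeight d i) := by
  simpa using wx_mul_mem_Vfil i (one_mem_Vfil n d)

lemma wd_mem_Vfil (d : ℕ) (i : Fin n) : wd i ∈ Vfil n d (coordWeight d i) := by
  simpa using wd_mul_mem_Vfil i (one_mem_Vfil n d)

lemma exists_mem_Vfil (d : ℕ) (w : Weyl n) : ∃ j, w ∈ Vfil n d j := by
  have key : ∀ v ∈ Weyl n, ∃ j, ∃ z ∈ Vfil n d j, z.1 = v := by
    intro v hv
    induction hv using Algebra.adjoin_induction with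
    | mem v hv =>
      obtain ⟨i, rfl⟩ | ⟨i, rfl⟩ := hv
      · exact ⟨_, _, wx_mem_Vfil d i, rfl⟩
      · exact ⟨_, _, wd_mem_Vfil d i, rfl⟩
    | algebraMap c =>
      refine ⟨0, algebraMap ℂ (Weyl n) c, ?_, rfl⟩
      rw [Algebra.algebraMap_eq_smul_one]
      exact Submodule.smul_mem _ c (one_mem_Vfil n d)
    | add a b _ _ iha ihb =>
      obtain ⟨i, y, hi, rfl⟩ := iha
      obtain ⟨j, z, hj, rfl⟩ := ihb
      exact ⟨max i j, y + z, add_mem (Vfil_mono n d (le_max_left i j) hi)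
        (Vfil_mono n d (le_max_right i j) hj), rfl⟩
    | mul a b _ _ iha ihb =>
      obtain ⟨i, y, hi, rfl⟩ := iha
      obtain ⟨j, z, hj, rfl⟩ := ihb
      exact ⟨i + j, y * z, mul_mem_Vfil hi hj, rfl⟩
  obtain ⟨j, z, hz, hzw⟩ := key w w.2
  exact ⟨j, Subtype.ext hzw ▸ hz⟩

section Rees

open AddMonoidAlgebra

/-- The generators `xᵢ`, `∂ᵢ` and `1`, placed in suitable degrees, of the Rees ring of the
`V_d`-filtration. -/
def reesGenerators (n d : ℕ) : Set (AddMonoidAlgebra (Weyl n) ℤ) :=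
  insert (single 1 1) (Set.range (fun i ↦ single (-coordWeight d i) (wx i)) ∪
    Set.range fun i ↦ single (coordWeight d i) (wd i))

/-- The Rees ring of the `V_d`-filtration. -/
def reesRing (n d : ℕ) : Subalgebra ℂ (AddMonoidAlgebra (Weyl n) ℤ) :=
  Algebra.adjoin ℂ (reesGenerators n d)

lemma single_mul_single_sub_mem_bot {D : Type*} [Ring D] [Algebra ℂ D] {k l : ℤ} {a b : D} {c : ℂ}
    (h : a * b - b * a = algebraMap ℂ D c) (hc : c ≠ 0 → k + l = 0) :
    single k a * single l b - single l b * single k a ∈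
      (⊥ : Subalgebra ℂ (AddMonoidAlgebra D ℤ)) := by
  rw [single_mul_single, single_mul_single, add_comm l k, ← single_sub, h]
  by_cases hc' : c = 0
  · rw [hc', map_zero, single_zero]
    exact zero_mem _
  · rw [hc hc']
    exact Algebra.mem_bot.2 ⟨c, rfl⟩

instance isNoetherianRing_reesRing (n d : ℕ) : IsNoetherianRing (reesRing n d) := by
  have hzero {k l : ℤ} {a b : Weyl n} (h : a * b = b * a) :
      single k a * single l b - single l b * single k a ∈
        (⊥ : Subalgebra ℂ (AddMonoidAlgebra (Weyl n) ℤ)) :=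
    single_mul_single_sub_mem_bot (c := 0) (by rw [h, sub_self, map_zero]) fun h ↦ (h rfl).elim
  have hdx (i j : Fin n) :
      single (coordWeight d i) (wd i) * single (-coordWeight d j) (wx j) -
        single (-coordWeight d j) (wx j) * single (coordWeight d i) (wd i) ∈
        (⊥ : Subalgebra ℂ (AddMonoidAlgebra (Weyl n) ℤ)) := by
    refine single_mul_single_sub_mem_bot (wd_mul_wx i j) fun h ↦ ?_
    obtain rfl : i = j := by
      by_contra hij
      exact h (if_neg hij)
    exact add_neg_cancel _
  refine isNoetherianRing_adjoin_of_commutator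
    (((Set.finite_range _).union (Set.finite_range _)).insert _) ?_
  rintro _ (rfl | ⟨i, rfl⟩ | ⟨i, rfl⟩) _ (rfl | ⟨j, rfl⟩ | ⟨j, rfl⟩)
  · exact hzero rfl
  · exact hzero ((one_mul _).trans (mul_one _).symm)
  · exact hzero ((one_mul _).trans (mul_one _).symm)
  · exact hzero ((mul_one _).trans (one_mul _).symm)
  · exact hzero (wx_commute i j)
  · rw [← neg_sub]
    exact neg_mem (hdx j i)
  · exact hzero ((mul_one _).trans (one_mul _).symm)
  · exact hdx i j
  · exact hzero (wd_commute i j)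

lemma coeff_mem_Vfil_of_mem_reesRing {n d : ℕ} {e : AddMonoidAlgebra (Weyl n) ℤ}
    (he : e ∈ reesRing n d) (j : ℤ) : e.coeff j ∈ Vfil n d j := by
  classical
  have hsingle {k : ℤ} {a : Weyl n} (ha : a ∈ Vfil n d k) (j : ℤ) :
      (single k a).coeff j ∈ Vfil n d j := by
    by_cases hk : j = k
    · subst hk
      have h : (single j a).coeff j = a := Finsupp.single_eq_same
      rwa [h]
    · have h : (single k a).coeff j = 0 := Finsupp.single_eq_of_ne hk
      rw [h]
      exact zero_mem _
  induction he using Algebra.adjoin_induction generalizing j with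
  | mem e he =>
    obtain rfl | ⟨i, rfl⟩ | ⟨i, rfl⟩ := he
    · exact hsingle (Vfil_mono n d zero_le_one (one_mem_Vfil n d)) j
    · exact hsingle (wx_mem_Vfil d i) j
    · exact hsingle (wd_mem_Vfil d i) j
  | algebraMap c =>
    have h : algebraMap ℂ (Weyl n) c ∈ Vfil n d 0 := by
      rw [Algebra.algebraMap_eq_smul_one]
      exact Submodule.smul_mem _ c (one_mem_Vfil n d)
    exact hsingle h j
  | add a b _ _ iha ihb => exact add_mem (iha j) (ihb j)
  | mul a b _ _ iha ihb =>
    have h := coeff_mul_sub_eq_sum a b b.coeff.support 0 j fun k hk ↦ by rwa [add_zero]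
    rw [sub_zero] at h
    rw [h]
    exact sum_mem fun k _ ↦ Vfil_mono n d (by lia) (mul_mem_Vfil (iha (j - k)) (ihb (k - 0)))

/-- The elements whose homogenization in degree `k` lies in the Rees ring. -/
def reesPart (n d : ℕ) (k : ℤ) : Submodule ℂ (Weyl n) where
  carrier := {a | single k a ∈ reesRing n d}
  add_mem' := fun {a b} ha hb ↦ by
    have h := (reesRing n d).add_mem ha hb
    rwa [← single_add] at h
  zero_mem' := by
    have h := zero_mem (reesRing n d)
    rwa [← single_zero k] at h
  smul_mem' := fun c a ha ↦ by
    have h := (reesRing n d).smul_mem ha c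
    rwa [smul_single] at h

lemma mem_reesPart {n d : ℕ} {k : ℤ} {a : Weyl n} :
    a ∈ reesPart n d k ↔ single k a ∈ reesRing n d := Iff.rfl

instance (n d : ℕ) : SetLike.GradedMonoid (reesPart n d) where
  one_mem := one_mem (reesRing n d)
  mul_mem := fun i j a b ha hb ↦ by
    rw [mem_reesPart, ← single_mul_single]
    exact mul_mem ha hb

lemma reesPart_mono (n d : ℕ) : Monotone (reesPart n d) := by
  refine monotone_int_of_le_succ fun k a ha ↦ ?_
  have h := SetLike.mul_mem_graded ha
    (Algebra.subset_adjoin (.inl rfl) : (1 : Weyl n) ∈ reesPart n d 1)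
  rwa [mul_one] at h

lemma single_mem_reesRing {n d : ℕ} {j : ℤ} {w : Weyl n} (hw : w ∈ Vfil n d j) :
    single j w ∈ reesRing n d := by
  refine Vfil_le (P := reesPart n d j) (fun α β h ↦ ?_) hw
  exact reesPart_mono n d (by lia) (wmono_mem_graded (d := d) (reesPart n d)
    (fun i ↦ Algebra.subset_adjoin (.inr (.inl ⟨i, rfl⟩)))
    (fun i ↦ Algebra.subset_adjoin (.inr (.inr ⟨i, rfl⟩))) α β)

lemma hasFilteredGenerators_Vfil (n d : ℕ) : HasFilteredGenerators (Vfil n d) :=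
  exists_filtered_generators (reesRing n d) (Vfil n d)
    (fun _ he ↦ coeff_mem_Vfil_of_mem_reesRing he) fun _ _ ↦ single_mem_reesRing

end Rees

end Weyl

/-- **Statement 9.** (Theorem: existence of quasi-isomorphic `V_d`-strict free
complexes.)  If `C^•` is a bounded complex of finitely generated left
`Dₙ`-modules, then there is a bounded-above complex `A^•` of finitely
generated free `Dₙ`-modules together with shift vectors `𝔪_•` which is
`V_d`-strict and quasi-isomorphic to `C^•`. -/
theorem exists_strict_free_complex_quasi_isomorphic
    (n d : ℕ) (hd : d ≤ n)
    (C : ℤ → Type) [∀ q, AddCommGroup (C q)] [∀ q, Module (Weyl n) (C q)]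
    (hfg : ∀ q, Module.Finite (Weyl n) (C q))
    (dC : ∀ i j : ℤ, C i →ₗ[Weyl n] C j)
    (hshape : ∀ i j : ℤ, j ≠ i + 1 → dC i j = 0)
    (hcomplex : ∀ i j k : ℤ, ∀ x, dC j k (dC i j x) = 0)
    (hbounded : ∃ a b : ℤ, ∀ q : ℤ, (q < a ∨ b < q) → ∀ x : C q, x = 0) :
    ∃ (r : ℤ → ℕ) (𝔪 : ∀ k : ℤ, Fin (r k) → ℤ)
      (φ : ∀ i j : ℤ, (Fin (r i) → Weyl n) →ₗ[Weyl n] (Fin (r j) → Weyl n))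
      (g : ∀ k : ℤ, (Fin (r k) → Weyl n) →ₗ[Weyl n] C k),
      -- A^• is bounded above
      (∃ N : ℤ, ∀ k : ℤ, N < k → r k = 0) ∧
      -- A^• is a complex
      (∀ i j : ℤ, j ≠ i + 1 → φ i j = 0) ∧
      (∀ i j k : ℤ, ∀ v, φ j k (φ i j v) = 0) ∧
      -- A^• is V_d-adapted and V_d-strict with respect to 𝔪_•
      (∀ k j : ℤ, ∀ v ∈ VfilFree n d (𝔪 k) j,
        φ k (k + 1) v ∈ VfilFree n d (𝔪 (k + 1)) j) ∧
      (∀ k j : ℤ, ∀ v ∈ VfilFree n d (𝔪 k) j,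
        (∃ u, φ (k - 1) k u = v) →
          ∃ u ∈ VfilFree n d (𝔪 (k - 1)) j, φ (k - 1) k u = v) ∧
      -- g is a chain map
      (∀ k : ℤ, ∀ v, g (k + 1) (φ k (k + 1) v) = dC k (k + 1) (g k v)) ∧
      -- g is a quasi-isomorphism: it induces an isomorphism on cohomology
      (∀ k : ℤ, ∀ x : C k, dC k (k + 1) x = 0 →
        ∃ v : Fin (r k) → Weyl n, φ k (k + 1) v = 0 ∧
          ∃ y : C (k - 1), x - g k v = dC (k - 1) k y) ∧
      (∀ k : ℤ, ∀ v : Fin (r k) → Weyl n, φ k (k + 1) v = 0 →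
        (∃ y : C (k - 1), g k v = dC (k - 1) k y) →
          ∃ u : Fin (r (k - 1)) → Weyl n, φ (k - 1) k u = v) := by
  obtain ⟨a, b, hb⟩ := hbounded
  obtain ⟨s, hs0, hs⟩ := exists_terms (Vfil_mono n d) (exists_mem_Vfil d)
    (fun _ _ _ ha _ hb ↦ mul_mem_Vfil ha hb) (hasFilteredGenerators_Vfil n d) C dC (b + 1)
    (fun q hq ↦ hb q (.inr hq))
  choose φ' hφ' using hs
  let φ (i j : ℤ) : (Fin (s i).rank → Weyl n) →ₗ[Weyl n] (Fin (s j).rank → Weyl n) :=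
    if h : i = j - 1 then φ' i j h else 0
  have hφ0 (i j : ℤ) (h : j ≠ i + 1) : φ i j = 0 := dif_neg (by lia)
  have hφ (i j : ℤ) (h : i = j - 1) :
      IsStrictDifferential (Vfil n d) (dC i j) (s i) (s j) (φ i j) := by
    have : φ i j = φ' i j h := dif_pos h
    rw [this]
    exact hφ' i j h
  refine ⟨fun q ↦ (s q).rank, fun q ↦ (s q).shift, φ, fun q ↦ (s q).aug,
    ⟨b, fun k hk ↦ hs0 k hk⟩, hφ0, fun i j k v ↦ ?_, fun k ↦ (hφ k (k + 1) (by lia)).adapted,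
    fun k ↦ (hφ (k - 1) k rfl).strict, fun k ↦ (hφ k (k + 1) (by lia)).aug_comm,
    fun k x hx ↦ ?_, fun k v hv hy ↦ ?_⟩
  · by_cases hij : j = i + 1
    · by_cases hjk : k = j + 1
      · exact ((hφ j k (by lia)).mem_cycles_left _).1
          (((hφ i j (by lia)).mem_range _).1 ⟨v, rfl⟩).1
      · rw [hφ0 j k hjk, LinearMap.zero_apply]
    · rw [hφ0 i j hij, LinearMap.zero_apply, map_zero]
  · obtain ⟨v, hv, hvx⟩ := (hφ k (k + 1) (by lia)).exists_aug_eq x hx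
    refine ⟨v, ((hφ k (k + 1) (by lia)).mem_cycles_left v).1 hv, 0, ?_⟩
    rw [hvx, sub_self, map_zero]
  · exact ((hφ (k - 1) k rfl).mem_range v).2
      ⟨((hφ k (k + 1) (by lia)).mem_cycles_left v).2 hv, hy⟩
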